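/- arXiv:2310.00846 — 2 statements merged into one kernel-verified Lean document; each statement's English description precedes it below -/
import Mathlib

section
/- Let G and H be simple graphs on n vertices with adjacency matrices A and B. Then det(xI−A)=det(xI−B) and det(xI−(J−I−A))=det(xI−(J−I−B)) hold if and only if there exists a real orthogonal matrix Q with Qe = e such that QᵀAQ = B. -/
open Matrix Polynomial

/-- A symmetric real 0-1 matrix with zero diagonal (adjacency matrix of a simple graph). -/
def IsAdjacencyMatrix {n : ℕ} (A : Matrix (Fin n) (Fin n) ℝ) : Prop :=
  A.IsSymm ∧ (∀ i, A i i = 0) ∧ ∀ i j, A i j = 0 ∨ A i j = 1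

open Finset Filter Topology in
/-- A rational function `∑ cᵢ / (dᵢ - y)` vanishing off its poles has vanishing residues. -/
theorem sum_residues_eq_zero {ι : Type*} [Fintype ι] (c d : ι → ℝ)
    (h : ∀ y, (∀ i, d i ≠ y) → ∑ i, c i / (d i - y) = 0) (t : ℝ) :
    ∑ i with d i = t, c i = 0 := by
  have hcont : ContinuousAt
      (fun y => ∑ i with d i = t, c i + (t - y) * ∑ i with d i ≠ t, c i / (d i - y)) t := by
    refine continuousAt_const.add ((continuousAt_const.sub continuousAt_id).mul ?_)
    refine tendsto_finsetSum _ fun i hi => ?_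
    refine ContinuousAt.div continuousAt_const (continuousAt_const.sub continuousAt_id) ?_
    exact sub_ne_zero.mpr (mem_filter.mp hi).2
  have hlim := hcont.tendsto.mono_left (nhdsWithin_le_nhds (s := {t}ᶜ))
  simp only [sub_self, zero_mul, add_zero] at hlim
  refine tendsto_nhds_unique (hlim.congr' ?_) tendsto_const_nhds
  have hfin : (Set.range d \ {t})ᶜ ∈ 𝓝[≠] t :=
    nhdsWithin_le_nhds
      (((Set.finite_range d).subset Set.sdiff_subset).isClosed.isOpen_compl.mem_nhds (by simp))
  filter_upwards [hfin, self_mem_nhdsWithin] with y hy hyt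
  have hyt : y ≠ t := hyt
  have hy' : ∀ i, d i ≠ y := fun i hi => hy ⟨⟨i, hi⟩, hyt⟩
  have hty : t - y ≠ 0 := sub_ne_zero.mpr hyt.symm
  have hsum := h y hy'
  rw [← sum_filter_add_sum_filter_not univ (fun i => d i = t)] at hsum
  have hpole : ∑ i with d i = t, c i = (t - y) * ∑ i with d i = t, c i / (d i - y) := by
    rw [mul_sum]
    refine sum_congr rfl fun i hi => ?_
    rw [(mem_filter.mp hi).2, mul_div_cancel₀ _ hty]
  rw [hpole, ← mul_add, hsum, mul_zero]

namespace Matrix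

variable {ι : Type*} [Fintype ι] [DecidableEq ι]

theorem charpoly_transpose_mul_mul {Q : Matrix ι ι ℝ} (hQ : Qᵀ * Q = 1) (M : Matrix ι ι ℝ) :
    (Qᵀ * M * Q).charpoly = M.charpoly := by
  rw [charpoly_mul_comm, ← Matrix.mul_assoc, mul_eq_one_comm.mp hQ, Matrix.one_mul]

theorem transpose_mul_vecMulVec_sub_one_sub_mul {Q : Matrix ι ι ℝ} (hQ : Qᵀ * Q = 1)
    (A : Matrix ι ι ℝ) (e : ι → ℝ) :
    Qᵀ * (vecMulVec e e - 1 - A) * Q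
      = vecMulVec (Qᵀ *ᵥ e) (Qᵀ *ᵥ e) - 1 - Qᵀ * A * Q := by
  simp only [Matrix.mul_sub, Matrix.sub_mul, Matrix.mul_one, hQ, mul_vecMulVec, vecMulVec_mul,
    mulVec_transpose]

theorem det_diagonal_sub_vecMulVec {d : ι → ℝ} (hd : ∀ i, d i ≠ 0) (a : ι → ℝ) :
    (diagonal d - vecMulVec a a).det = (∏ i, d i) * (1 - ∑ i, a i ^ 2 / d i) := by
  have hfact : diagonal d - vecMulVec a a
      = diagonal d * (1 + replicateCol Unit (fun i => -(a i / d i)) * replicateRow Unit a) := by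
    ext i j
    rw [diagonal_mul]
    simp only [sub_apply, vecMulVec_apply, add_apply, mul_apply, replicateCol_apply,
      replicateRow_apply, Finset.univ_unique, Finset.sum_singleton, diagonal_apply, one_apply]
    have := hd i
    split_ifs <;> field_simp <;> ring
  rw [hfact, det_mul, det_diagonal, det_one_add_replicateCol_mul_replicateRow, dotProduct,
    sub_eq_add_neg, ← Finset.sum_neg_distrib]
  congr 2
  exact Finset.sum_congr rfl fun i _ => by ring

theorem sum_sq_eq_of_charpoly_eq {d a b : ι → ℝ}
    (h : (vecMulVec a a - 1 - diagonal d).charpoly = (vecMulVec b b - 1 - diagonal d).charpoly)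
    (t : ℝ) :
    ∑ i with d i = t, a i ^ 2 = ∑ i with d i = t, b i ^ 2 := by
  have eval_eq (v : ι → ℝ) (y : ℝ) (hy : ∀ i, d i - y ≠ 0) :
      (vecMulVec v v - 1 - diagonal d).charpoly.eval (-1 - y)
        = (∏ i, (d i - y)) * (1 - ∑ i, v i ^ 2 / (d i - y)) := by
    rw [eval_charpoly, ← det_diagonal_sub_vecMulVec hy]
    congr 1
    ext i j
    simp only [scalar_apply, sub_apply, diagonal_apply, one_apply]
    split_ifs <;> ring
  rw [← sub_eq_zero, ← Finset.sum_sub_distrib]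
  refine sum_residues_eq_zero _ d (fun y hy => ?_) t
  have hy' : ∀ i, d i - y ≠ 0 := fun i => sub_ne_zero.mpr (hy i)
  have heval := congrArg (Polynomial.eval (-1 - y)) h
  rw [eval_eq a y hy', eval_eq b y hy'] at heval
  have := mul_left_cancel₀ (Finset.prod_ne_zero_iff.mpr fun i _ => hy' i) heval
  simp only [sub_div, Finset.sum_sub_distrib]
  linarith

/-- If `a` and `b` have equal norms on each level set of `d`, then a product of Householder
reflections, one for each level set, maps `b` to `a` and commutes with `diagonal d`. -/
theorem exists_orthogonal_commute_diagonal_mulVec_eq {d a b : ι → ℝ}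
    (h : ∀ t, ∑ i with d i = t, a i ^ 2 = ∑ i with d i = t, b i ^ 2) :
    ∃ W : Matrix ι ι ℝ, Wᵀ * W = 1 ∧ Wᵀ * diagonal d * W = diagonal d ∧ W *ᵥ b = a := by
  set w : ι → ℝ := a - b with hw
  set s : ℝ → ℝ := fun t => ∑ i with d i = t, w i ^ 2 with hs
  let P : Matrix ι ι ℝ := of fun i j => if d j = d i then w i * w j / s (d i) else 0
  have w_eq_zero (i : ι) (hi : s (d i) = 0) : w i = 0 := by
    have := (Finset.sum_eq_zero_iff_of_nonneg fun j _ => sq_nonneg (w j)).mp hi i (by simp)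
    exact pow_eq_zero_iff two_ne_zero |>.mp this
  have P_symm : Pᵀ = P := by
    ext i j
    simp only [transpose_apply, P, of_apply]
    by_cases hij : d i = d j
    · simp [hij, mul_comm]
    · simp [hij, Ne.symm hij]
  have P_idem : P * P = P := by
    ext i j
    simp only [mul_apply, P, of_apply, ite_mul, zero_mul, ← Finset.sum_filter]
    have hterm : ∀ k ∈ Finset.univ.filter (fun k => d k = d i),
        (w i * w k / s (d i) * if d j = d k then w k * w j / s (d k) else 0)
          = (if d j = d i then w i * w j / s (d i) / s (d i) else 0) * w k ^ 2 := by
      intro k hk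
      rw [(Finset.mem_filter.mp hk).2]
      split_ifs <;> ring
    rw [Finset.sum_congr rfl hterm, ← Finset.mul_sum]
    change _ * s (d i) = _
    split_ifs
    · by_cases hi : s (d i) = 0
      · simp [hi]
      · field_simp
    · simp
  have P_comm : P * diagonal d = diagonal d * P := by
    ext i j
    rw [mul_diagonal, diagonal_mul]
    simp only [P, of_apply]
    split_ifs with hij
    · rw [hij, mul_comm]
    · simp
  have W_sq : (1 - (2 : ℝ) • P) * (1 - (2 : ℝ) • P) = 1 := by
    simp only [Matrix.mul_sub, Matrix.sub_mul, Matrix.mul_one, Matrix.one_mul, Matrix.smul_mul,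
      Matrix.mul_smul, P_idem]
    module
  have W_comm : (1 - (2 : ℝ) • P) * diagonal d = diagonal d * (1 - (2 : ℝ) • P) := by
    simp [Matrix.mul_sub, Matrix.sub_mul, P_comm]
  have W_symm : (1 - (2 : ℝ) • P)ᵀ = 1 - (2 : ℝ) • P := by simp [P_symm]
  refine ⟨1 - (2 : ℝ) • P, ?_, ?_, ?_⟩
  · rw [W_symm, W_sq]
  · rw [W_symm, W_comm, Matrix.mul_assoc, W_sq, Matrix.mul_one]
  · ext i
    have hdot : 2 * ∑ k with d k = d i, w k * b k = - s (d i) := by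
      have hsq := h (d i)
      rw [← sub_eq_zero, ← Finset.sum_sub_distrib] at hsq
      rw [eq_neg_iff_add_eq_zero, hs, Finset.mul_sum, ← Finset.sum_add_distrib, ← hsq]
      refine Finset.sum_congr rfl fun k _ => ?_
      simp only [hw, Pi.sub_apply]
      ring
    have hPb : (P *ᵥ b) i = w i / s (d i) * ∑ k with d k = d i, w k * b k := by
      simp only [mulVec, dotProduct, P, of_apply, ite_mul, zero_mul, ← Finset.sum_filter]
      rw [Finset.mul_sum]
      exact Finset.sum_congr rfl fun k _ => by ring
    have hPb' : 2 * (P *ᵥ b) i = - w i := by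
      rw [hPb, mul_left_comm, hdot]
      by_cases hi : s (d i) = 0
      · simp [w_eq_zero i hi]
      · field_simp
    simp only [sub_mulVec, one_mulVec, smul_mulVec, Pi.sub_apply, Pi.smul_apply, smul_eq_mul,
      hPb', hw]
    ring

theorem IsHermitian.exists_orthogonal_transpose_mul_mul_eq_diagonal {A : Matrix ι ι ℝ}
    (hA : A.IsHermitian) :
    ∃ U : Matrix ι ι ℝ, Uᵀ * U = 1 ∧ Uᵀ * A * U = diagonal hA.eigenvalues := by
  have hU : (hA.eigenvectorUnitary : Matrix ι ι ℝ)ᵀ * hA.eigenvectorUnitary = 1 := by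
    have := Unitary.coe_star_mul_self hA.eigenvectorUnitary
    rwa [star_eq_conjTranspose, conjTranspose_eq_transpose_of_trivial] at this
  refine ⟨hA.eigenvectorUnitary, hU, ?_⟩
  have hspec := hA.spectral_theorem
  rw [Unitary.conjStarAlgAut_apply, star_eq_conjTranspose,
    conjTranspose_eq_transpose_of_trivial] at hspec
  generalize (hA.eigenvectorUnitary : Matrix ι ι ℝ) = U at hU hspec
  have hdiag : (diagonal (RCLike.ofReal ∘ hA.eigenvalues) : Matrix ι ι ℝ)
      = diagonal hA.eigenvalues := rfl
  rw [hdiag] at hspec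
  generalize hA.eigenvalues = d at hspec
  rw [hspec, Matrix.mul_assoc, Matrix.mul_assoc, hU, Matrix.mul_one, ← Matrix.mul_assoc, hU,
    Matrix.one_mul]

/-- Two real symmetric matrices that are cospectral, and whose generalized complements with
respect to `e` are cospectral, are conjugate by an orthogonal matrix fixing `e`. -/
theorem exists_orthogonal_fixing_of_charpoly_eq {A B : Matrix ι ι ℝ} (hA : A.IsHermitian)
    (hB : B.IsHermitian) (e : ι → ℝ) (h : A.charpoly = B.charpoly)
    (h' : (vecMulVec e e - 1 - A).charpoly = (vecMulVec e e - 1 - B).charpoly) :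
    ∃ Q : Matrix ι ι ℝ, Qᵀ * Q = 1 ∧ Q *ᵥ e = e ∧ Qᵀ * A * Q = B := by
  obtain ⟨U, hU, hUA⟩ := hA.exists_orthogonal_transpose_mul_mul_eq_diagonal
  obtain ⟨V, hV, hVB⟩ := hB.exists_orthogonal_transpose_mul_mul_eq_diagonal
  rw [← (hA.eigenvalues_eq_eigenvalues_iff hB).mpr h] at hVB
  generalize hA.eigenvalues = d at hUA hVB
  have hU' := mul_eq_one_comm.mp hU
  have hV' := mul_eq_one_comm.mp hV
  rw [← charpoly_transpose_mul_mul hU, ← charpoly_transpose_mul_mul hV (_ - B),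
    transpose_mul_vecMulVec_sub_one_sub_mul hU, transpose_mul_vecMulVec_sub_one_sub_mul hV,
    hUA, hVB] at h'
  obtain ⟨W, hW, hWd, hWe⟩ :=
    exists_orthogonal_commute_diagonal_mulVec_eq (sum_sq_eq_of_charpoly_eq h')
  refine ⟨U * W * Vᵀ, ?_, ?_, ?_⟩
  · calc (U * W * Vᵀ)ᵀ * (U * W * Vᵀ) = V * (Wᵀ * (Uᵀ * U) * W) * Vᵀ := by
          simp only [transpose_mul, transpose_transpose, Matrix.mul_assoc]
      _ = 1 := by rw [hU, Matrix.mul_one, hW, Matrix.mul_one, hV']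
  · rw [← mulVec_mulVec, ← mulVec_mulVec, hWe, mulVec_mulVec, hU', one_mulVec]
  · calc (U * W * Vᵀ)ᵀ * A * (U * W * Vᵀ) = V * (Wᵀ * (Uᵀ * A * U) * W) * Vᵀ := by
          simp only [transpose_mul, transpose_transpose, Matrix.mul_assoc]
      _ = V * (Vᵀ * B * V) * Vᵀ := by rw [hUA, hWd, hVB]
      _ = (V * Vᵀ) * B * (V * Vᵀ) := by simp only [Matrix.mul_assoc]
      _ = B := by rw [hV', Matrix.mul_one, Matrix.one_mul]

end Matrix

theorem stmt3 {n : ℕ} (A B : Matrix (Fin n) (Fin n) ℝ)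
    (hA : IsAdjacencyMatrix A) (hB : IsAdjacencyMatrix B) :
    (A.charpoly = B.charpoly ∧
      ((Matrix.of fun _ _ => (1 : ℝ)) - 1 - A).charpoly
        = ((Matrix.of fun _ _ => (1 : ℝ)) - 1 - B).charpoly)
    ↔ ∃ Q : Matrix (Fin n) (Fin n) ℝ,
        Qᵀ * Q = 1 ∧ (Q *ᵥ fun _ => (1 : ℝ)) = (fun _ => (1 : ℝ)) ∧
        Qᵀ * A * Q = B := by
  have hJ : (Matrix.of fun _ _ => (1 : ℝ) : Matrix (Fin n) (Fin n) ℝ)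
      = vecMulVec (fun _ => 1) (fun _ => 1) := by
    ext i j
    simp [vecMulVec_apply]
  rw [hJ]
  constructor
  · rintro ⟨h, h'⟩
    exact exists_orthogonal_fixing_of_charpoly_eq
      ((conjTranspose_eq_transpose_of_trivial A).trans hA.1)
      ((conjTranspose_eq_transpose_of_trivial B).trans hB.1) _ h h'
  · rintro ⟨Q, hQ, hQe, rfl⟩
    have hQe' : (Qᵀ *ᵥ fun _ => (1 : ℝ)) = fun _ => 1 := by
      nth_rw 1 [← hQe]
      rw [mulVec_mulVec, hQ, one_mulVec]
    refine ⟨(charpoly_transpose_mul_mul hQ A).symm, ?_⟩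
    rw [← charpoly_transpose_mul_mul hQ, transpose_mul_vecMulVec_sub_one_sub_mul hQ, hQe']
end

section
/- Let G and H be simple graphs on n vertices with adjacency matrices A and B, and suppose the walk matrix W(A) = [e, Ae, …, A^{n−1}e] is invertible. If Q is a real orthogonal matrix with Qe = e and QᵀAQ = B, then the walk matrix W(B) is also invertible and Q = W(A)·W(B)^{−1}; in particular Q has rational entries and is the unique orthogonal matrix Q' with Q'e = e and Q'ᵀAQ' = B. -/
open Matrix Polynomial

/-- The walk matrix `[e, Ae, A²e, …, A^{n−1}e]` of an `n × n` real matrix `A`. -/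
def walkMatrix {n : ℕ} (A : Matrix (Fin n) (Fin n) ℝ) : Matrix (Fin n) (Fin n) ℝ :=
  Matrix.of fun i j => ((A ^ (j : ℕ)) *ᵥ fun _ => (1 : ℝ)) i

/-- Rational entries are inherited by the walk matrix. -/
theorem exists_walkMatrix_eq_mapMatrix {n : ℕ} {A : Matrix (Fin n) (Fin n) ℝ}
    (hA : ∃ A₀ : Matrix (Fin n) (Fin n) ℚ, A = (Rat.castHom ℝ).mapMatrix A₀) :
    ∃ W₀ : Matrix (Fin n) (Fin n) ℚ, walkMatrix A = (Rat.castHom ℝ).mapMatrix W₀ := by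
  obtain ⟨A₀, rfl⟩ := hA
  refine ⟨Matrix.of fun i j => ((A₀ ^ (j : ℕ)) *ᵥ fun _ => (1 : ℚ)) i, ?_⟩
  ext i j
  simp only [walkMatrix, ← map_pow]
  simp [Matrix.mulVec, dotProduct]

/-- Rational entries are inherited by the inverse of an invertible matrix. -/
theorem exists_inv_eq_mapMatrix {n : ℕ} {M : Matrix (Fin n) (Fin n) ℝ} (hdet : M.det ≠ 0)
    (hM : ∃ M₀ : Matrix (Fin n) (Fin n) ℚ, M = (Rat.castHom ℝ).mapMatrix M₀) :
    ∃ N₀ : Matrix (Fin n) (Fin n) ℚ, M⁻¹ = (Rat.castHom ℝ).mapMatrix N₀ := by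
  obtain ⟨M₀, rfl⟩ := hM
  have h₀ : IsUnit M₀.det := by
    rw [isUnit_iff_ne_zero]
    intro h
    exact hdet (by rw [← RingHom.map_det, h, map_zero])
  refine ⟨M₀⁻¹, Matrix.inv_eq_right_inv ?_⟩
  rw [← map_mul, Matrix.mul_nonsing_inv _ h₀, map_one]

theorem IsAdjacencyMatrix.exists_eq_mapMatrix {n : ℕ} {A : Matrix (Fin n) (Fin n) ℝ}
    (hA : IsAdjacencyMatrix A) :
    ∃ A₀ : Matrix (Fin n) (Fin n) ℚ, A = (Rat.castHom ℝ).mapMatrix A₀ := by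
  refine ⟨Matrix.of fun i j => if A i j = 0 then 0 else 1, ?_⟩
  ext i j
  rcases hA.2.2 i j with h | h <;> simp [h]

/-- A regular orthogonal similarity carries one walk matrix to the other. -/
theorem mul_walkMatrix_of_regular_orthogonal {n : ℕ} {A B Q : Matrix (Fin n) (Fin n) ℝ}
    (hQorth : Qᵀ * Q = 1)
    (hQreg : (Q *ᵥ fun _ => (1 : ℝ)) = (fun _ => (1 : ℝ)))
    (hQsim : Qᵀ * A * Q = B) : Q * walkMatrix B = walkMatrix A := by
  have hsemi : SemiconjBy Q B A := by
    rw [SemiconjBy, ← hQsim, ← Matrix.mul_assoc, ← Matrix.mul_assoc,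
      mul_eq_one_comm.mp hQorth, Matrix.one_mul]
  ext i j
  change (Q *ᵥ ((B ^ (j : ℕ)) *ᵥ fun _ => (1 : ℝ))) i = ((A ^ (j : ℕ)) *ᵥ fun _ => (1 : ℝ)) i
  rw [Matrix.mulVec_mulVec, (hsemi.pow_right (j : ℕ)).eq, ← Matrix.mulVec_mulVec, hQreg]

theorem stmt4 {n : ℕ} (A B : Matrix (Fin n) (Fin n) ℝ)
    (hA : IsAdjacencyMatrix A) (hB : IsAdjacencyMatrix B)
    (hW : (walkMatrix A).det ≠ 0)
    (Q : Matrix (Fin n) (Fin n) ℝ)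
    (hQorth : Qᵀ * Q = 1)
    (hQreg : (Q *ᵥ fun _ => (1 : ℝ)) = (fun _ => (1 : ℝ)))
    (hQsim : Qᵀ * A * Q = B) :
    (walkMatrix B).det ≠ 0 ∧
    Q = walkMatrix A * (walkMatrix B)⁻¹ ∧
    (∀ i j, ∃ q : ℚ, Q i j = (q : ℝ)) ∧
    ∀ Q' : Matrix (Fin n) (Fin n) ℝ,
      Q'ᵀ * Q' = 1 → (Q' *ᵥ fun _ => (1 : ℝ)) = (fun _ => (1 : ℝ)) →
      Q'ᵀ * A * Q' = B → Q' = Q := by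
  have hmul := mul_walkMatrix_of_regular_orthogonal hQorth hQreg hQsim
  have hWB : (walkMatrix B).det ≠ 0 := by
    rw [← hmul, Matrix.det_mul] at hW
    exact right_ne_zero_of_mul hW
  have hformula : ∀ P : Matrix (Fin n) (Fin n) ℝ, P * walkMatrix B = walkMatrix A →
      P = walkMatrix A * (walkMatrix B)⁻¹ := by
    intro P hP
    rw [← hP, Matrix.mul_nonsing_inv_cancel_right _ _ (isUnit_iff_ne_zero.mpr hWB)]
  refine ⟨hWB, hformula Q hmul, fun i j => ?_, fun Q' horth hreg hsim => ?_⟩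
  · obtain ⟨M, hM⟩ := exists_walkMatrix_eq_mapMatrix hA.exists_eq_mapMatrix
    obtain ⟨N, hN⟩ := exists_inv_eq_mapMatrix hWB
      (exists_walkMatrix_eq_mapMatrix hB.exists_eq_mapMatrix)
    refine ⟨(M * N) i j, ?_⟩
    rw [hformula Q hmul, hM, hN, ← map_mul]
    rfl
  · rw [hformula Q hmul,
      hformula Q' (mul_walkMatrix_of_regular_orthogonal horth hreg hsim)]
end
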